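/- Let U ⊂ ℝ^q be an open box, V ⊂ ℝ an open interval, and let y : U → V and g : U×V → ℝ be sufficiently smooth with g(x, y(x)) = 0 and g_{0,1}(x, y(x)) ≠ 0 for all x ∈ U. Then for any x₀ ∈ U and any nonzero n ∈ ℕ^q, y_n(x₀)/n! = Σ_{0 = p₀ < p₁ < ⋯ < p_{|n|} = n} Σ_{τ' ∈ 𝒯'(p₀,…,p_{|n|})} Π_{★ ∈ Stars(τ')} ( −(1/(s^★! t^★!)) · g_{s^★,t^★}(x₀, y(x₀)) / g_{0,1}(x₀, y(x₀)) ), where the outer sum is over unit-step lattice paths from 0 to n, 𝒯'(p₀,…,p_{|n|}) is the set of plane trees with leaves labeled (p₀,p₁),(p₁,p₂),…,(p_{|n|−1},p_{|n|}) in left-to-right depth-first order (nonleaf vertices labeled recursively by concatenation as in 𝒯) in which every star is of some type (s^★,t^★) ≠ (0,1), Stars(τ') is the set of stars of τ', and (s^★,t^★) is the type of the star ★. -/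

import Mathlib

namespace ImplicitDD

/-- The `r`-th standard unit multi-index in `ℕ^q`. -/
def unitv (q : ℕ) (r : Fin q) : Fin q → ℕ := fun j => if j = r then 1 else 0

end ImplicitDD

namespace ImplicitDD

/-- The sequence `i₀, i₁, …, i_k` of multi-indices in the box `[0, n]` encoded by `p`,
extended to all of `ℕ` (constant beyond index `k`). -/
def extPath {q k : ℕ} (n : Fin q → ℕ) (p : Fin (k + 1) → ∀ j : Fin q, Fin (n j + 1)) :
    ℕ → Fin q → ℕ :=
  fun m j => (p ⟨min m k, Nat.lt_succ_of_le (min_le_right m k)⟩ j : ℕ)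

/-- `p` encodes a strictly increasing sequence `0 = i₀ < i₁ < ⋯ < i_k = n` in `ℕ^q`. -/
def IsIncrSeq {q k : ℕ} (n : Fin q → ℕ) (p : Fin (k + 1) → ∀ j : Fin q, Fin (n j + 1)) :
    Prop :=
  extPath n p 0 = (fun _ => 0) ∧ extPath n p k = n ∧
    ∀ m : ℕ, m < k → extPath n p m < extPath n p (m + 1)

/-- `p` encodes a lattice path `0 = p₀ < p₁ < ⋯ < p_k = n` with unit coordinate steps. -/
def IsUnitPath {q k : ℕ} (n : Fin q → ℕ) (p : Fin (k + 1) → ∀ j : Fin q, Fin (n j + 1)) :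
    Prop :=
  extPath n p 0 = (fun _ => 0) ∧ extPath n p k = n ∧
    ∀ m : ℕ, m < k → ∃ r : Fin q,
      extPath n p (m + 1) = fun j => extPath n p m j + unitv q r j

end ImplicitDD

namespace ImplicitDD

/-- A plane tree: a root together with a linearly ordered (possibly empty) list of subtrees. -/
inductive PTree : Type where
  | node : List PTree → PTree

/-- The number of vertices of a plane tree. -/
def PTree.vertexCount : PTree → ℕ
  | .node ts => 1 + (ts.attach.map fun t => PTree.vertexCount t.1).sum
decreasing_by
  have := List.sizeOf_lt_of_mem t.2
  simp only [PTree.node.sizeOf_spec]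
  omega

/-- The number of leaves of a plane tree (a single vertex counts as one leaf). -/
def PTree.leafCount : PTree → ℕ
  | .node [] => 1
  | .node ts => (ts.attach.map fun t => PTree.leafCount t.1).sum
decreasing_by
  have := List.sizeOf_lt_of_mem t.2
  simp only [PTree.node.sizeOf_spec]
  omega

/-- Every nonleaf vertex of the plane tree has at least two descendants. -/
def PTree.Branching : PTree → Prop
  | .node ts => ts.length ≠ 1 ∧ ∀ t ∈ ts, PTree.Branching t
decreasing_by
  have := List.sizeOf_lt_of_mem ‹_ ∈ ts›
  simp only [PTree.node.sizeOf_spec]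
  omega

/-- The number of vertices of a plane tree having exactly `i` descendants. -/
def PTree.degCount (i : ℕ) : PTree → ℕ
  | .node ts => (if ts.length = i then 1 else 0) + (ts.attach.map fun t => PTree.degCount i t.1).sum
decreasing_by
  have := List.sizeOf_lt_of_mem t.2
  simp only [PTree.node.sizeOf_spec]
  omega

end ImplicitDD

namespace ImplicitDD

/-- The descriptors of the ordered children of a vertex whose subtrees are `ts`, the leftmost
leaf below the vertex being leaf number `o`: a leaf child is recorded as `some j`, where `j` is
its leaf number (so that its label is `(p_j, p_{j+1})`), and a nonleaf child as `none`. -/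
def starRow : List PTree → ℕ → List (Option ℕ)
  | [], _ => []
  | .node [] :: ts, o => some o :: starRow ts (o + 1)
  | t :: ts, o => none :: starRow ts (o + t.leafCount)

mutual
/-- The stars of the nonleaf vertices of a plane tree (each recorded by the list of descriptors
of the ordered children of its root), the leftmost leaf being leaf number `o`. -/
def PTree.stars : PTree → ℕ → List (List (Option ℕ))
  | .node [], _ => []
  | .node ts, o => starRow ts o :: starsList ts o

/-- The stars of a forest, starting at leaf offset `o`. -/
def starsList : List PTree → ℕ → List (List (Option ℕ))
  | [], _ => []
  | t :: ts, o => PTree.stars t o ++ starsList ts (o + t.leafCount)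
end

/-- The number `s_r` of initial leaf-children of a star whose leaf steps equal `e_r`, with
respect to the lattice path `pth`: the `r`-th component of the type `(s₁,…,s_q,t)` of the
star `σ`. -/
def starS {q : ℕ} (pth : ℕ → Fin q → ℕ) (σ : List (Option ℕ)) (r : Fin q) : ℕ :=
  σ.countP fun c =>
    match c with
    | none => false
    | some j => decide (pth (j + 1) = fun j' => pth j j' + unitv q r j')

/-- The number `t` of nonleaf children of a star: the last component of its type. -/
def starT (σ : List (Option ℕ)) : ℕ := σ.countP fun c => c.isNone

/-- The star `σ` is of some type `(s₁,…,s_q,t)` with respect to the lattice path `pth`: its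
children consist of leaves with steps `e₁`, then leaves with steps `e₂`, …, then leaves with
steps `e_q`, followed by nonleaves. -/
def StarHasType {q : ℕ} (pth : ℕ → Fin q → ℕ) (σ : List (Option ℕ)) : Prop :=
  (∀ a b : ℕ, a < b → σ[a]? = some none → ∀ j : ℕ, σ[b]? ≠ some (some j)) ∧
  (∀ a b : ℕ, a < b → ∀ ja jb : ℕ, σ[a]? = some (some ja) → σ[b]? = some (some jb) →
    ∀ ra rb : Fin q, pth (ja + 1) = (fun j' => pth ja j' + unitv q ra j') →
      pth (jb + 1) = (fun j' => pth jb j' + unitv q rb j') → ra ≤ rb)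

end ImplicitDD

namespace ImplicitDD

/-- The partial derivative of `f : ℝ^q → ℝ` in the `i`-th coordinate direction. -/
noncomputable def pderiv {q : ℕ} (i : Fin q) (f : (Fin q → ℝ) → ℝ) : (Fin q → ℝ) → ℝ :=
  fun v => deriv (fun s => f (Function.update v i s)) (v i)

/-- The iterated partial derivative `∂^{|m|} f / ∂x^m` for a multi-index `m ∈ ℕ^q`. -/
noncomputable def mPDeriv {q : ℕ} (m : Fin q → ℕ) (f : (Fin q → ℝ) → ℝ) :
    (Fin q → ℝ) → ℝ :=
  ((List.ofFn fun j : Fin q => List.replicate (m j) j).flatten).foldr pderiv f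

/-- The mixed partial derivative `g_{s,t} = ∂^{|s|+t} g / ∂x^s ∂y^t` of `g : ℝ^q × ℝ → ℝ`. -/
noncomputable def gPDeriv {q : ℕ} (g : (Fin q → ℝ) → ℝ → ℝ) (S : Fin q → ℕ) (t : ℕ) :
    (Fin q → ℝ) → ℝ → ℝ :=
  fun v w => mPDeriv S (fun v' => deriv^[t] (g v') w) v

end ImplicitDD

namespace ImplicitDD

section Calculus

open scoped ContDiff

variable {E : Type*} [NormedAddCommGroup E] [NormedSpace ℝ E]

theorem contDiffOn_fderiv_apply {Ω : Set E} (hΩ : IsOpen Ω) {F : E → ℝ}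
    (hF : ContDiffOn ℝ ∞ F Ω) (a : E) : ContDiffOn ℝ ∞ (fun x => fderiv ℝ F x a) Ω :=
  (hF.fderiv_of_isOpen hΩ (by simp)).clm_apply contDiffOn_const

theorem differentiableAt_of_contDiffOn {Ω : Set E} (hΩ : IsOpen Ω) {F : E → ℝ}
    (hF : ContDiffOn ℝ ∞ F Ω) {x : E} (hx : x ∈ Ω) : DifferentiableAt ℝ F x :=
  (hF.contDiffAt (hΩ.mem_nhds hx)).differentiableAt (by simp)

theorem fderiv_fderiv_apply_comm {Ω : Set E} (hΩ : IsOpen Ω) {F : E → ℝ}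
    (hF : ContDiffOn ℝ ∞ F Ω) (a b : E) {x : E} (hx : x ∈ Ω) :
    fderiv ℝ (fun z => fderiv ℝ F z a) x b = fderiv ℝ (fun z => fderiv ℝ F z b) x a := by
  have hd : DifferentiableAt ℝ (fderiv ℝ F) x :=
    ((hF.fderiv_of_isOpen hΩ (m := ∞) (by simp)).contDiffAt (hΩ.mem_nhds hx)).differentiableAt
      (by simp)
  have hs : IsSymmSndFDerivAt ℝ F x :=
    (hF.contDiffAt (hΩ.mem_nhds hx)).isSymmSndFDerivAt
      (by simpa using WithTop.coe_le_coe.2 (le_top : (2 : ℕ∞) ≤ ⊤))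
  have key (u v : E) : fderiv ℝ (fun z => fderiv ℝ F z u) x v = fderiv ℝ (fderiv ℝ F) x v u := by
    rw [fderiv_clm_apply hd (differentiableAt_const u)]
    simp
  rw [key, key, hs.eq]

variable {q : ℕ} {U : Set (Fin q → ℝ)} {V : Set ℝ}

theorem pderiv_eq_fderiv (i : Fin q) {f : (Fin q → ℝ) → ℝ} {v : Fin q → ℝ}
    (hf : DifferentiableAt ℝ f v) : pderiv i f v = fderiv ℝ f v (Pi.single i 1) := by
  have h := hasDerivAt_update v i (v i)
  have hf' : HasFDerivAt f (fderiv ℝ f v) (Function.update v i (v i)) := by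
    simpa using hf.hasFDerivAt
  exact (hf'.comp_hasDerivAt (v i) h).deriv

theorem pderiv_congr (hU : IsOpen U) (i : Fin q) {f f' : (Fin q → ℝ) → ℝ}
    (h : Set.EqOn f f' U) : Set.EqOn (pderiv i f) (pderiv i f') U := by
  intro v hv
  refine Filter.EventuallyEq.deriv_eq ?_
  have hc : Filter.Tendsto (fun s : ℝ => Function.update v i s) (nhds (v i)) (nhds v) := by
    have h1 : Continuous fun s : ℝ => Function.update v i s := by fun_prop
    simpa using h1.tendsto (v i)
  filter_upwards [hc.eventually (hU.mem_nhds hv)] with s hs using h hs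

theorem contDiffOn_pderiv (hU : IsOpen U) (i : Fin q) {f : (Fin q → ℝ) → ℝ}
    (hf : ContDiffOn ℝ ∞ f U) : ContDiffOn ℝ ∞ (pderiv i f) U :=
  (contDiffOn_fderiv_apply hU hf (Pi.single i 1)).congr fun _ hv =>
    pderiv_eq_fderiv i (differentiableAt_of_contDiffOn hU hf hv)

theorem eqOn_pderiv_fderiv (hU : IsOpen U) (i : Fin q) {f : (Fin q → ℝ) → ℝ}
    (hf : ContDiffOn ℝ ∞ f U) :
    Set.EqOn (pderiv i f) (fun v => fderiv ℝ f v (Pi.single i 1)) U := fun _ hv =>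
  pderiv_eq_fderiv i (differentiableAt_of_contDiffOn hU hf hv)

theorem pderiv_comm (hU : IsOpen U) (i j : Fin q) {f : (Fin q → ℝ) → ℝ}
    (hf : ContDiffOn ℝ ∞ f U) :
    Set.EqOn (pderiv i (pderiv j f)) (pderiv j (pderiv i f)) U := by
  have key (a b : Fin q) : Set.EqOn (pderiv a (pderiv b f))
      (fun v => fderiv ℝ (fun z => fderiv ℝ f z (Pi.single b 1)) v (Pi.single a 1)) U :=
    (pderiv_congr hU a (eqOn_pderiv_fderiv hU b hf)).trans
      (eqOn_pderiv_fderiv hU a (contDiffOn_fderiv_apply hU hf _))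
  intro v hv
  rw [key i j hv, key j i hv]
  exact fderiv_fderiv_apply_comm hU hf _ _ hv

theorem pderiv_add (hU : IsOpen U) (i : Fin q) {f h : (Fin q → ℝ) → ℝ}
    (hf : ContDiffOn ℝ ∞ f U) (hh : ContDiffOn ℝ ∞ h U) :
    Set.EqOn (pderiv i fun v => f v + h v) (fun v => pderiv i f v + pderiv i h v) U := by
  intro v hv
  have h1 := differentiableAt_of_contDiffOn hU hf hv
  have h2 := differentiableAt_of_contDiffOn hU hh hv
  simp only [pderiv_eq_fderiv i h1, pderiv_eq_fderiv i h2]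
  rw [pderiv_eq_fderiv i (h1.fun_add h2), fderiv_fun_add h1 h2]
  rfl

theorem pderiv_mul (hU : IsOpen U) (i : Fin q) {f h : (Fin q → ℝ) → ℝ}
    (hf : ContDiffOn ℝ ∞ f U) (hh : ContDiffOn ℝ ∞ h U) :
    Set.EqOn (pderiv i fun v => f v * h v) (fun v => pderiv i f v * h v + f v * pderiv i h v) U := by
  intro v hv
  have h1 := differentiableAt_of_contDiffOn hU hf hv
  have h2 := differentiableAt_of_contDiffOn hU hh hv
  simp only [pderiv_eq_fderiv i h1, pderiv_eq_fderiv i h2]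
  rw [pderiv_eq_fderiv i (h1.fun_mul h2), fderiv_fun_mul h1 h2]
  simp
  ring

/-- The word listing `m j` copies of each letter `j`, in increasing order; `mPDeriv` differentiates
along this word. -/
def sortedWord (m : Fin q → ℕ) : List (Fin q) :=
  (List.ofFn fun j : Fin q => List.replicate (m j) j).flatten

theorem count_sortedWord (m : Fin q → ℕ) (j : Fin q) : (sortedWord m).count j = m j := by
  rw [sortedWord, List.count_flatten, List.map_ofFn, List.sum_ofFn]
  simp [List.count_replicate]

theorem sortedWord_add_single (m : Fin q → ℕ) (i : Fin q) :
    (sortedWord (m + Pi.single i 1)).Perm (sortedWord m ++ [i]) := by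
  rw [List.perm_iff_count]
  intro a
  rw [List.count_append, count_sortedWord, count_sortedWord]
  simp [List.count_singleton, Pi.single_apply, eq_comm (a := i)]

theorem sortedWord_zero : sortedWord (0 : Fin q → ℕ) = [] := by
  simp [sortedWord]

theorem foldr_pderiv_congr (hU : IsOpen U) (l : List (Fin q)) {f f' : (Fin q → ℝ) → ℝ}
    (h : Set.EqOn f f' U) : Set.EqOn (l.foldr pderiv f) (l.foldr pderiv f') U := by
  induction l with
  | nil => exact h
  | cons a l ih => exact pderiv_congr hU a ih

theorem contDiffOn_foldr_pderiv (hU : IsOpen U) (l : List (Fin q)) {f : (Fin q → ℝ) → ℝ}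
    (hf : ContDiffOn ℝ ∞ f U) : ContDiffOn ℝ ∞ (l.foldr pderiv f) U := by
  induction l with
  | nil => exact hf
  | cons a l ih => exact contDiffOn_pderiv hU a ih

theorem foldr_pderiv_perm (hU : IsOpen U) {l l' : List (Fin q)} (h : l.Perm l')
    {f : (Fin q → ℝ) → ℝ} (hf : ContDiffOn ℝ ∞ f U) :
    Set.EqOn (l.foldr pderiv f) (l'.foldr pderiv f) U := by
  induction h with
  | nil => exact fun _ _ => rfl
  | cons a _ ih => exact pderiv_congr hU a ih
  | swap a b l => exact pderiv_comm hU b a (contDiffOn_foldr_pderiv hU l hf)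
  | trans _ _ ih ih' => exact ih.trans ih'

theorem mPDeriv_congr (hU : IsOpen U) (m : Fin q → ℕ) {f f' : (Fin q → ℝ) → ℝ}
    (h : Set.EqOn f f' U) : Set.EqOn (mPDeriv m f) (mPDeriv m f') U :=
  foldr_pderiv_congr hU _ h

theorem mPDeriv_zero (f : (Fin q → ℝ) → ℝ) : mPDeriv 0 f = f := by
  change (sortedWord 0).foldr pderiv f = f
  rw [sortedWord_zero, List.foldr_nil]

theorem mPDeriv_add_single (hU : IsOpen U) (m : Fin q → ℕ) (i : Fin q) {f : (Fin q → ℝ) → ℝ}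
    (hf : ContDiffOn ℝ ∞ f U) :
    Set.EqOn (mPDeriv (m + Pi.single i 1) f) (mPDeriv m (pderiv i f)) U := by
  have := foldr_pderiv_perm hU (sortedWord_add_single m i) hf
  rwa [List.foldr_append] at this

/-- Slices `v ↦ G v w` of a smooth function are smooth. -/
theorem contDiffOn_slice {G : (Fin q → ℝ) → ℝ → ℝ}
    (hG : ContDiffOn ℝ ∞ (fun p : (Fin q → ℝ) × ℝ => G p.1 p.2) (U ×ˢ V)) {w : ℝ} (hw : w ∈ V) :
    ContDiffOn ℝ ∞ (fun v => G v w) U :=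
  hG.comp (f := fun v => (v, w)) (by fun_prop) fun _ hv => ⟨hv, hw⟩

theorem deriv_eq_fderiv_prod (hU : IsOpen U) (hV : IsOpen V) {G : (Fin q → ℝ) → ℝ → ℝ}
    (hG : ContDiffOn ℝ ∞ (fun p : (Fin q → ℝ) × ℝ => G p.1 p.2) (U ×ˢ V)) {p : (Fin q → ℝ) × ℝ}
    (hp : p ∈ U ×ˢ V) :
    deriv (G p.1) p.2 = fderiv ℝ (fun p : (Fin q → ℝ) × ℝ => G p.1 p.2) p (0, 1) := by
  have h := (differentiableAt_of_contDiffOn (hU.prod hV) hG hp).hasFDerivAt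
  have h' : HasDerivAt (fun w : ℝ => (p.1, w)) ((0 : Fin q → ℝ), (1 : ℝ)) p.2 :=
    (hasDerivAt_const _ _).prodMk (hasDerivAt_id _)
  exact (HasFDerivAt.comp_hasDerivAt (x := p.2) (f := fun w : ℝ => (p.1, w)) h h').deriv

theorem pderiv_eq_fderiv_prod (hU : IsOpen U) (hV : IsOpen V) (i : Fin q)
    {G : (Fin q → ℝ) → ℝ → ℝ}
    (hG : ContDiffOn ℝ ∞ (fun p : (Fin q → ℝ) × ℝ => G p.1 p.2) (U ×ˢ V)) {p : (Fin q → ℝ) × ℝ}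
    (hp : p ∈ U ×ˢ V) :
    pderiv i (fun v => G v p.2) p.1
      = fderiv ℝ (fun p : (Fin q → ℝ) × ℝ => G p.1 p.2) p (Pi.single i 1, 0) := by
  rw [pderiv_eq_fderiv i
    (differentiableAt_of_contDiffOn hU (contDiffOn_slice hG hp.2) hp.1)]
  have h := (differentiableAt_of_contDiffOn (hU.prod hV) hG hp).hasFDerivAt
  have h' : HasFDerivAt (fun v : Fin q → ℝ => (v, p.2))
      ((ContinuousLinearMap.id ℝ (Fin q → ℝ)).prod 0) p.1 :=
    (hasFDerivAt_id _).prodMk (hasFDerivAt_const _ _)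
  have h2 := (HasFDerivAt.comp (x := p.1) (f := fun v : Fin q → ℝ => (v, p.2))
    (g := fun p : (Fin q → ℝ) × ℝ => G p.1 p.2) h h').fderiv
  exact (DFunLike.congr_fun h2 (Pi.single i 1)).trans (by simp)

theorem contDiffOn_deriv_snd (hU : IsOpen U) (hV : IsOpen V) {G : (Fin q → ℝ) → ℝ → ℝ}
    (hG : ContDiffOn ℝ ∞ (fun p : (Fin q → ℝ) × ℝ => G p.1 p.2) (U ×ˢ V)) :
    ContDiffOn ℝ ∞ (fun p : (Fin q → ℝ) × ℝ => deriv (G p.1) p.2) (U ×ˢ V) :=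
  (contDiffOn_fderiv_apply (hU.prod hV) hG (0, 1)).congr fun _ hp =>
    deriv_eq_fderiv_prod hU hV hG hp

theorem contDiffOn_pderiv_fst (hU : IsOpen U) (hV : IsOpen V) (i : Fin q)
    {G : (Fin q → ℝ) → ℝ → ℝ}
    (hG : ContDiffOn ℝ ∞ (fun p : (Fin q → ℝ) × ℝ => G p.1 p.2) (U ×ˢ V)) :
    ContDiffOn ℝ ∞ (fun p : (Fin q → ℝ) × ℝ => pderiv i (fun v => G v p.2) p.1) (U ×ˢ V) :=
  (contDiffOn_fderiv_apply (hU.prod hV) hG (Pi.single i 1, 0)).congr fun _ hp =>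
    pderiv_eq_fderiv_prod hU hV i hG hp

theorem pderiv_deriv_comm (hU : IsOpen U) (hV : IsOpen V) (i : Fin q) {G : (Fin q → ℝ) → ℝ → ℝ}
    (hG : ContDiffOn ℝ ∞ (fun p : (Fin q → ℝ) × ℝ => G p.1 p.2) (U ×ˢ V))
    {v : Fin q → ℝ} {w : ℝ} (hv : v ∈ U) (hw : w ∈ V) :
    pderiv i (fun v' => deriv (G v') w) v = deriv (fun w' => pderiv i (fun v' => G v' w') v) w := by
  have hΩ := hU.prod hV
  have hp : (v, w) ∈ U ×ˢ V := ⟨hv, hw⟩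
  have h1 := pderiv_eq_fderiv_prod hU hV i (G := fun v => deriv (G v))
    (contDiffOn_deriv_snd hU hV hG) hp
  have h2 := deriv_eq_fderiv_prod hU hV (G := fun v w => pderiv i (fun v' => G v' w) v)
    (contDiffOn_pderiv_fst hU hV i hG) hp
  have e1 : (fun p : (Fin q → ℝ) × ℝ => deriv (G p.1) p.2) =ᶠ[nhds (v, w)]
      fun p => fderiv ℝ (fun p : (Fin q → ℝ) × ℝ => G p.1 p.2) p (0, 1) := by
    filter_upwards [hΩ.mem_nhds hp] with p hp using deriv_eq_fderiv_prod hU hV hG hp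
  have e2 : (fun p : (Fin q → ℝ) × ℝ => pderiv i (fun v => G v p.2) p.1) =ᶠ[nhds (v, w)]
      fun p => fderiv ℝ (fun p : (Fin q → ℝ) × ℝ => G p.1 p.2) p (Pi.single i 1, 0) := by
    filter_upwards [hΩ.mem_nhds hp] with p hp using pderiv_eq_fderiv_prod hU hV i hG hp
  refine h1.trans (Eq.trans ?_ h2.symm)
  rw [e1.fderiv_eq, e2.fderiv_eq]
  exact fderiv_fderiv_apply_comm hΩ hG _ _ hp

theorem iterate_deriv_congr (hV : IsOpen V) (t : ℕ) {f f' : ℝ → ℝ} (h : Set.EqOn f f' V) :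
    Set.EqOn (deriv^[t] f) (deriv^[t] f') V := by
  induction t generalizing f f' with
  | zero => exact h
  | succ t ih => exact ih fun w hw => (h.eventuallyEq_of_mem (hV.mem_nhds hw)).deriv_eq

theorem contDiffOn_iterate_deriv (hU : IsOpen U) (hV : IsOpen V) (t : ℕ)
    {G : (Fin q → ℝ) → ℝ → ℝ}
    (hG : ContDiffOn ℝ ∞ (fun p : (Fin q → ℝ) × ℝ => G p.1 p.2) (U ×ˢ V)) :
    ContDiffOn ℝ ∞ (fun p : (Fin q → ℝ) × ℝ => deriv^[t] (G p.1) p.2) (U ×ˢ V) := by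
  induction t generalizing G with
  | zero => exact hG
  | succ t ih => exact ih (G := fun v => deriv (G v)) (contDiffOn_deriv_snd hU hV hG)

theorem pderiv_iterate_deriv (hU : IsOpen U) (hV : IsOpen V) (i : Fin q) (t : ℕ)
    {G : (Fin q → ℝ) → ℝ → ℝ}
    (hG : ContDiffOn ℝ ∞ (fun p : (Fin q → ℝ) × ℝ => G p.1 p.2) (U ×ˢ V)) {w : ℝ} (hw : w ∈ V) :
    Set.EqOn (pderiv i fun v => deriv^[t] (G v) w)
      (fun v => deriv^[t] (fun w' => pderiv i (fun v' => G v' w') v) w) U := by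
  induction t generalizing G with
  | zero => exact fun _ _ => rfl
  | succ t ih =>
    intro v hv
    refine (ih (G := fun v => deriv (G v)) (contDiffOn_deriv_snd hU hV hG) hv).trans ?_
    exact iterate_deriv_congr hV t (fun w' hw' => pderiv_deriv_comm hU hV i hG hv hw') hw

theorem contDiffOn_graph {y : (Fin q → ℝ) → ℝ} (hy : ContDiffOn ℝ ∞ y U)
    (hmaps : Set.MapsTo y U V) {G : (Fin q → ℝ) → ℝ → ℝ}
    (hG : ContDiffOn ℝ ∞ (fun p : (Fin q → ℝ) × ℝ => G p.1 p.2) (U ×ˢ V)) :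
    ContDiffOn ℝ ∞ (fun v => G v (y v)) U :=
  hG.comp (f := fun v => (v, y v)) (contDiffOn_id.prodMk hy) fun _ hv => ⟨hv, hmaps hv⟩

/-- The chain rule for `v ↦ G v (y v)`. -/
theorem pderiv_graph (hU : IsOpen U) (hV : IsOpen V) (i : Fin q) {y : (Fin q → ℝ) → ℝ}
    (hy : ContDiffOn ℝ ∞ y U) (hmaps : Set.MapsTo y U V) {G : (Fin q → ℝ) → ℝ → ℝ}
    (hG : ContDiffOn ℝ ∞ (fun p : (Fin q → ℝ) × ℝ => G p.1 p.2) (U ×ˢ V)) :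
    Set.EqOn (pderiv i fun v => G v (y v))
      (fun v => pderiv i (fun v' => G v' (y v)) v + deriv (G v) (y v) * pderiv i y v) U := by
  intro v hv
  have hp : (v, y v) ∈ U ×ˢ V := ⟨hv, hmaps hv⟩
  have hyd := differentiableAt_of_contDiffOn hU hy hv
  have h := (differentiableAt_of_contDiffOn (hU.prod hV) hG hp).hasFDerivAt
  have h' : HasFDerivAt (fun v' => (v', y v'))
      ((ContinuousLinearMap.id ℝ (Fin q → ℝ)).prod (fderiv ℝ y v)) v :=
    (hasFDerivAt_id _).prodMk hyd.hasFDerivAt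
  have h2 := (HasFDerivAt.comp (x := v) (f := fun v' => (v', y v'))
    (g := fun p : (Fin q → ℝ) × ℝ => G p.1 p.2) h h').fderiv
  have e1 := pderiv_eq_fderiv_prod hU hV i hG hp
  have e2 := deriv_eq_fderiv_prod hU hV hG hp
  simp only at e1 e2 ⊢
  rw [e1, e2, pderiv_eq_fderiv i hyd,
    pderiv_eq_fderiv i (differentiableAt_of_contDiffOn hU (contDiffOn_graph hy hmaps hG) hv)]
  refine (DFunLike.congr_fun h2 (Pi.single i 1)).trans ?_
  have : ((Pi.single i 1 : Fin q → ℝ), fderiv ℝ y v (Pi.single i 1))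
      = (Pi.single i 1, 0) + fderiv ℝ y v (Pi.single i 1) • ((0 : Fin q → ℝ), (1 : ℝ)) := by
    simp
  simp only [ContinuousLinearMap.comp_apply, ContinuousLinearMap.prod_apply,
    ContinuousLinearMap.id_apply]
  rw [this, map_add, map_smul, smul_eq_mul, mul_comm]

end Calculus

end ImplicitDD

namespace ImplicitDD

section Taylor

open scoped ContDiff Nat
open MvPowerSeries (coeff)

variable {q : ℕ} {U : Set (Fin q → ℝ)} {V : Set ℝ} {x₀ : Fin q → ℝ}

/-- The formal Taylor series of `f` at `x₀`. -/
noncomputable def taylor (x₀ : Fin q → ℝ) (f : (Fin q → ℝ) → ℝ) : MvPowerSeries (Fin q) ℝ :=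
  fun n => mPDeriv n f x₀ / ∏ j, ((n j)! : ℝ)

theorem coeff_taylor (f : (Fin q → ℝ) → ℝ) (n : Fin q →₀ ℕ) :
    coeff n (taylor x₀ f) = mPDeriv n f x₀ / ∏ j, ((n j)! : ℝ) := rfl

theorem coeff_zero_taylor (f : (Fin q → ℝ) → ℝ) : coeff 0 (taylor x₀ f) = f x₀ := by
  rw [coeff_taylor, Finsupp.coe_zero, mPDeriv_zero]
  simp

theorem taylor_congr (hU : IsOpen U) (hx : x₀ ∈ U) {f f' : (Fin q → ℝ) → ℝ}
    (h : Set.EqOn f f' U) : taylor x₀ f = taylor x₀ f' := by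
  ext n
  rw [coeff_taylor, coeff_taylor, mPDeriv_congr hU n h hx]

theorem mPDeriv_add (hU : IsOpen U) (m : Fin q → ℕ) {f h : (Fin q → ℝ) → ℝ}
    (hf : ContDiffOn ℝ ∞ f U) (hh : ContDiffOn ℝ ∞ h U) :
    Set.EqOn (mPDeriv m fun v => f v + h v) (fun v => mPDeriv m f v + mPDeriv m h v) U := by
  unfold mPDeriv
  generalize (List.ofFn fun j : Fin q => List.replicate (m j) j).flatten = l
  induction l with
  | nil => exact fun _ _ => rfl
  | cons a l ih =>
    exact (pderiv_congr hU a ih).trans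
      (pderiv_add hU a (contDiffOn_foldr_pderiv hU l hf) (contDiffOn_foldr_pderiv hU l hh))

theorem taylor_add (hU : IsOpen U) (hx : x₀ ∈ U) {f h : (Fin q → ℝ) → ℝ}
    (hf : ContDiffOn ℝ ∞ f U) (hh : ContDiffOn ℝ ∞ h U) :
    taylor x₀ (fun v => f v + h v) = taylor x₀ f + taylor x₀ h := by
  ext n
  rw [map_add, coeff_taylor, coeff_taylor, coeff_taylor, mPDeriv_add hU n hf hh hx, add_div]

theorem pderiv_taylor (hU : IsOpen U) (hx : x₀ ∈ U) (i : Fin q) {f : (Fin q → ℝ) → ℝ}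
    (hf : ContDiffOn ℝ ∞ f U) :
    MvPowerSeries.pderiv ℝ i (taylor x₀ f) = taylor x₀ (pderiv i f) := by
  ext n
  have hfac : ∏ j, (((n + Finsupp.single i 1 : Fin q →₀ ℕ) j)! : ℝ)
      = (∏ j, ((n j)! : ℝ)) * (n i + 1) := by
    have (j : Fin q) : (((n + Finsupp.single i 1 : Fin q →₀ ℕ) j)! : ℝ)
        = ((n j)! : ℝ) * if j = i then (n i + 1 : ℝ) else 1 := by
      by_cases h : j = i
      · subst h
        simp [Nat.factorial_succ, mul_comm]
      · simp [h]
    simp only [this, Finset.prod_mul_distrib]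
    simp
  have hpos : (∏ j, ((n j)! : ℝ)) ≠ 0 :=
    Finset.prod_ne_zero_iff.2 fun j _ => by positivity
  have hi : (n i + 1 : ℝ) ≠ 0 := by positivity
  have hm := mPDeriv_add_single hU n i hf hx
  rw [MvPowerSeries.coeff_pderiv, coeff_taylor, coeff_taylor, hfac, ← hm, Finsupp.coe_add,
    Finsupp.single_eq_pi_single]
  field_simp

/-- Two power series have the same coefficient at a nonzero index as soon as some partial
derivatives do at the shifted index. -/
theorem coeff_add_single_eq {A B : MvPowerSeries (Fin q) ℝ} {m : Fin q →₀ ℕ} {i : Fin q}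
    (h : coeff m (MvPowerSeries.pderiv ℝ i A) = coeff m (MvPowerSeries.pderiv ℝ i B)) :
    coeff (m + Finsupp.single i 1) A = coeff (m + Finsupp.single i 1) B := by
  rw [MvPowerSeries.coeff_pderiv, MvPowerSeries.coeff_pderiv] at h
  exact mul_right_cancel₀ (by positivity) h

theorem exists_eq_add_single {n : Fin q →₀ ℕ} (h : n ≠ 0) :
    ∃ m i, n = m + Finsupp.single i 1 := by
  obtain ⟨i, hi⟩ := Finsupp.ne_iff.mp h
  refine ⟨n - Finsupp.single i 1, i, (tsub_add_cancel_of_le ?_).symm⟩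
  simpa [Finsupp.single_le_iff, Nat.one_le_iff_ne_zero] using hi

theorem coeff_mul_congr {A A' B : MvPowerSeries (Fin q) ℝ} {d : ℕ}
    (h : ∀ m : Fin q →₀ ℕ, m.degree ≤ d → coeff m A = coeff m A') {n : Fin q →₀ ℕ}
    (hn : n.degree ≤ d) : coeff n (A * B) = coeff n (A' * B) := by
  rw [MvPowerSeries.coeff_mul, MvPowerSeries.coeff_mul]
  refine Finset.sum_congr rfl fun x hx => ?_
  rw [h x.1 (le_trans ?_ hn)]
  rw [← Finset.HasAntidiagonal.mem_antidiagonal.1 hx, map_add]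
  exact Nat.le_add_right _ _

theorem taylor_mul (hU : IsOpen U) (hx : x₀ ∈ U) {f h : (Fin q → ℝ) → ℝ}
    (hf : ContDiffOn ℝ ∞ f U) (hh : ContDiffOn ℝ ∞ h U) :
    taylor x₀ (fun v => f v * h v) = taylor x₀ f * taylor x₀ h := by
  suffices H : ∀ (d : ℕ) (n : Fin q →₀ ℕ), n.degree = d → ∀ {f h : (Fin q → ℝ) → ℝ},
      ContDiffOn ℝ ∞ f U → ContDiffOn ℝ ∞ h U →
      coeff n (taylor x₀ fun v => f v * h v) = coeff n (taylor x₀ f * taylor x₀ h) from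
    MvPowerSeries.ext fun n => H _ n rfl hf hh
  intro d
  induction d with
  | zero =>
    intro n hn f h _ _
    obtain rfl : n = 0 := (Finsupp.degree_eq_zero_iff n).1 hn
    simp [coeff_zero_taylor, MvPowerSeries.coeff_mul]
  | succ d ih =>
    intro n hn f h hf hh
    obtain ⟨m, i, rfl⟩ := exists_eq_add_single (n := n) (by rintro rfl; simp at hn)
    have hm : m.degree = d := by simpa using hn
    have hfi := contDiffOn_pderiv hU i hf
    have hhi := contDiffOn_pderiv hU i hh
    apply coeff_add_single_eq
    rw [pderiv_taylor hU hx i (hf.mul hh), taylor_congr hU hx (pderiv_mul hU i hf hh),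
      taylor_add hU hx (hfi.mul hh) (hf.mul hhi), map_add, ih m hm hfi hh, ih m hm hf hhi,
      Derivation.leibniz, pderiv_taylor hU hx i hf, pderiv_taylor hU hx i hh, map_add,
      smul_eq_mul, smul_eq_mul, mul_comm (taylor x₀ h), add_comm]

/-- The truncation to degree `< K` in the second variable of the formal composition of the Taylor
series of `G` at `(x₀, w)` with the power series `Y`. -/
noncomputable def compSeries (x₀ : Fin q → ℝ) (w : ℝ) (Y : MvPowerSeries (Fin q) ℝ) (K : ℕ)
    (G : (Fin q → ℝ) → ℝ → ℝ) : MvPowerSeries (Fin q) ℝ :=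
  ∑ t ∈ Finset.range K, (1 / t ! : ℝ) • (taylor x₀ (fun v => deriv^[t] (G v) w) * Y ^ t)

theorem pderiv_compSeries (hU : IsOpen U) (hV : IsOpen V) (hx : x₀ ∈ U) {w : ℝ} (hw : w ∈ V)
    (Y : MvPowerSeries (Fin q) ℝ) (K : ℕ) (i : Fin q) {G : (Fin q → ℝ) → ℝ → ℝ}
    (hG : ContDiffOn ℝ ∞ (fun p : (Fin q → ℝ) × ℝ => G p.1 p.2) (U ×ˢ V)) :
    MvPowerSeries.pderiv ℝ i (compSeries x₀ w Y (K + 1) G)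
      = compSeries x₀ w Y (K + 1) (fun v w' => pderiv i (fun v' => G v' w') v)
        + compSeries x₀ w Y K (fun v => deriv (G v)) * MvPowerSeries.pderiv ℝ i Y := by
  have key (t : ℕ) : MvPowerSeries.pderiv ℝ i
        ((1 / t ! : ℝ) • (taylor x₀ (fun v => deriv^[t] (G v) w) * Y ^ t))
      = (1 / t ! : ℝ) • (taylor x₀
          (fun v => deriv^[t] (fun w' => pderiv i (fun v' => G v' w') v) w) * Y ^ t)
        + (1 / t ! : ℝ) • (taylor x₀ (fun v => deriv^[t] (G v) w)
          * ((t : MvPowerSeries (Fin q) ℝ) * Y ^ (t - 1))) * MvPowerSeries.pderiv ℝ i Y := by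
    rw [Derivation.map_smul, Derivation.leibniz, MvPowerSeries.pderiv_pow,
      pderiv_taylor hU hx i (contDiffOn_slice (G := fun v => deriv^[t] (G v))
        (contDiffOn_iterate_deriv hU hV t hG) hw),
      taylor_congr hU hx (pderiv_iterate_deriv hU hV i t hG hw), add_comm, smul_add,
      smul_eq_mul, smul_eq_mul, smul_mul_assoc, mul_comm (Y ^ t)]
    congr 2
    ring
  simp only [compSeries, map_sum, key, Finset.sum_add_distrib]
  congr 1
  rw [Finset.sum_range_succ', Finset.sum_mul]
  simp only [Nat.cast_zero, zero_mul, mul_zero, smul_zero, add_zero]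
  refine Finset.sum_congr rfl fun t _ => ?_
  congr 1
  have h1 : (1 / ((t + 1)! : ℝ)) * ((t + 1 : ℕ) : ℝ) = 1 / t ! := by
    rw [Nat.factorial_succ]
    push_cast
    have : (t ! : ℝ) ≠ 0 := by positivity
    field_simp
  rw [← h1, mul_smul]
  congr 1
  rw [Nat.add_sub_cancel, mul_left_comm, ← nsmul_eq_mul, Nat.cast_smul_eq_nsmul]
  rfl

/-- Formal Taylor expansion of `v ↦ G v (y v)`. -/
theorem coeff_taylor_graph (hU : IsOpen U) (hV : IsOpen V) (hx : x₀ ∈ U)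
    {y : (Fin q → ℝ) → ℝ} (hy : ContDiffOn ℝ ∞ y U) (hmaps : Set.MapsTo y U V)
    {G : (Fin q → ℝ) → ℝ → ℝ}
    (hG : ContDiffOn ℝ ∞ (fun p : (Fin q → ℝ) × ℝ => G p.1 p.2) (U ×ˢ V))
    {n : Fin q →₀ ℕ} {K : ℕ} (hK : n.degree < K) :
    coeff n (taylor x₀ fun v => G v (y v))
      = coeff n (compSeries x₀ (y x₀) (taylor x₀ y - MvPowerSeries.C (y x₀)) K G) := by
  set Y := taylor x₀ y - MvPowerSeries.C (y x₀) with hY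
  have hY0 : coeff 0 Y = 0 := by
    rw [hY, map_sub, coeff_zero_taylor, MvPowerSeries.coeff_zero_C, sub_self]
  suffices H : ∀ (d : ℕ) (n : Fin q →₀ ℕ), n.degree ≤ d → ∀ (K : ℕ), n.degree < K →
      ∀ {G : (Fin q → ℝ) → ℝ → ℝ},
      ContDiffOn ℝ ∞ (fun p : (Fin q → ℝ) × ℝ => G p.1 p.2) (U ×ˢ V) →
      coeff n (taylor x₀ fun v => G v (y v)) = coeff n (compSeries x₀ (y x₀) Y K G) from
    H _ n le_rfl K hK hG
  have base : ∀ (K : ℕ), 0 < K → ∀ G : (Fin q → ℝ) → ℝ → ℝ,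
      coeff 0 (taylor x₀ fun v => G v (y v)) = coeff 0 (compSeries x₀ (y x₀) Y K G) := by
    intro K hK G
    obtain ⟨K, rfl⟩ := Nat.exists_eq_add_of_lt hK
    rw [zero_add, compSeries, Finset.sum_range_succ', map_add, map_sum, coeff_zero_taylor]
    have hz (t : ℕ) : coeff 0 ((1 / (t + 1)! : ℝ) •
        (taylor x₀ (fun v => deriv^[t + 1] (G v) (y x₀)) * Y ^ (t + 1))) = 0 := by
      rw [MvPowerSeries.coeff_smul, pow_succ, ← mul_assoc,
        MvPowerSeries.coeff_zero_eq_constantCoeff_apply, map_mul,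
        ← MvPowerSeries.coeff_zero_eq_constantCoeff_apply Y, hY0, mul_zero, mul_zero]
    rw [Finset.sum_eq_zero fun t _ => hz t]
    simp [coeff_zero_taylor]
  intro d
  induction d with
  | zero =>
    intro n hn K hK G _
    obtain rfl : n = 0 := (Finsupp.degree_eq_zero_iff n).1 (Nat.le_zero.1 hn)
    exact base K (Nat.zero_lt_of_lt hK) G
  | succ d ih =>
    intro n hn K hK G hG
    by_cases hn0 : n = 0
    · subst hn0
      exact base K (Nat.zero_lt_of_lt hK) G
    obtain ⟨m, i, rfl⟩ := exists_eq_add_single hn0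
    rw [map_add, Finsupp.degree_single] at hn hK
    obtain ⟨K, rfl⟩ : ∃ K', K = K' + 1 := ⟨K - 1, by omega⟩
    have hGi := contDiffOn_pderiv_fst hU hV i hG
    have hGy := contDiffOn_deriv_snd hU hV hG
    have hgraph1 := contDiffOn_graph (G := fun v w' => pderiv i (fun v' => G v' w') v) hy hmaps hGi
    have hgraph2 := contDiffOn_graph (G := fun v => deriv (G v)) hy hmaps hGy
    have hyi := contDiffOn_pderiv hU i hy
    have hYi : MvPowerSeries.pderiv ℝ i Y = taylor x₀ (pderiv i y) := by
      rw [hY, map_sub, MvPowerSeries.pderiv_C, sub_zero, pderiv_taylor hU hx i hy]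
    apply coeff_add_single_eq
    rw [pderiv_compSeries hU hV hx (hmaps hx) Y K i hG,
      pderiv_taylor hU hx i (contDiffOn_graph hy hmaps hG),
      taylor_congr hU hx (pderiv_graph hU hV i hy hmaps hG),
      taylor_add hU hx hgraph1 (hgraph2.mul hyi), taylor_mul hU hx hgraph2 hyi, map_add, map_add,
      hYi]
    congr 1
    · exact ih m (by omega) (K + 1) (by omega)
        (G := fun v w' => pderiv i (fun v' => G v' w') v) hGi
    · exact coeff_mul_congr (d := m.degree)
        (fun l hl => ih l (by omega) K (by omega) (G := fun v => deriv (G v)) hGy) le_rfl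

end Taylor

end ImplicitDD

namespace ImplicitDD

open MvPowerSeries (coeff)

/-- Plane forests all of whose vertices `v` carry a multi-index `s_v`, in first-child/next-sibling
form: `cons s c r` is the forest whose first root is labelled `s` and has the forest `c` as its
children, followed by the forest `r`. -/
inductive SForest (q : ℕ) : Type where
  | nil : SForest q
  | cons (s : Fin q →₀ ℕ) (c r : SForest q) : SForest q

namespace SForest

variable {q : ℕ}

/-- The number of trees of a forest. -/
def len : SForest q → ℕ
  | nil => 0
  | cons _ _ r => r.len + 1

/-- The number of vertices of a forest. -/
def size : SForest q → ℕ
  | nil => 0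
  | cons _ c r => c.size + r.size + 1

/-- The sum of the labels of a forest. -/
noncomputable def content : SForest q → (Fin q →₀ ℕ)
  | nil => 0
  | cons s c r => s + c.content + r.content

/-- No vertex has label `0` and at most one child. -/
def Good : SForest q → Prop
  | nil => True
  | cons s c r => ¬ (s = 0 ∧ c.len ≤ 1) ∧ c.Good ∧ r.Good

/-- The product over all vertices of `a s t`, `s` being the label and `t` the number of
children. -/
def wt (a : (Fin q →₀ ℕ) → ℕ → ℝ) : SForest q → ℝ
  | nil => 1
  | cons s c r => a s c.len * c.wt a * r.wt a

theorem len_le_size (f : SForest q) : f.len ≤ f.size := by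
  induction f with
  | nil => exact le_rfl
  | cons s c r _ ihr => simp only [len, size]; omega

theorem Good.size_add_len_le {f : SForest q} (hf : f.Good) :
    f.size + f.len ≤ 2 * f.content.degree := by
  induction f with
  | nil => simp [size, len]
  | cons s c r ihc ihr =>
    obtain ⟨h, hc, hr⟩ := hf
    have h1 := ihc hc
    have h2 := ihr hr
    have h3 : s.degree = 0 → 1 < c.len := fun hs => by
      by_contra h4
      exact h ⟨(Finsupp.degree_eq_zero_iff s).1 hs, by omega⟩
    simp only [size, len, content, map_add]
    omega

theorem Good.len_le_degree {f : SForest q} (hf : f.Good) : f.len ≤ f.content.degree := by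
  have h1 := hf.size_add_len_le
  have h2 := f.len_le_size
  omega

theorem finite_size_le_content_le (n : Fin q →₀ ℕ) (k : ℕ) :
    {f : SForest q | f.size ≤ k ∧ f.content ≤ n}.Finite := by
  induction k with
  | zero =>
    refine (Set.finite_singleton nil).subset fun f hf => ?_
    cases f with
    | nil => rfl
    | cons s c r => simp [size] at hf
  | succ k ih =>
    refine ((Set.finite_singleton nil).union
      (((Set.finite_Iic n).prod (ih.prod ih)).image fun x => cons x.1 x.2.1 x.2.2)).subset
        fun f hf => ?_
    cases f with
    | nil => exact Or.inl rfl
    | cons s c r =>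
      obtain ⟨h1, h2⟩ := hf
      simp only [size] at h1
      simp only [content] at h2
      refine Or.inr ⟨(s, c, r), ⟨?_, ⟨?_, ?_⟩, ⟨?_, ?_⟩⟩, rfl⟩
      · exact le_trans (le_trans le_self_add le_self_add) h2
      · simp only; omega
      · exact le_trans (le_trans le_add_self le_self_add) h2
      · simp only; omega
      · exact le_trans le_add_self h2

theorem finite_good (t : ℕ) (n : Fin q →₀ ℕ) :
    {f : SForest q | f.Good ∧ f.len = t ∧ f.content = n}.Finite :=
  (finite_size_le_content_le n (2 * n.degree)).subset fun f ⟨hf, _, hn⟩ =>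
    ⟨by have := hf.size_add_len_le; rw [hn] at this; omega, hn.le⟩

/-- The good forests of `t` trees with content `n`. -/
noncomputable def goodForests (t : ℕ) (n : Fin q →₀ ℕ) : Finset (SForest q) :=
  (finite_good t n).toFinset

theorem mem_goodForests {t : ℕ} {n : Fin q →₀ ℕ} {f : SForest q} :
    f ∈ goodForests t n ↔ f.Good ∧ f.len = t ∧ f.content = n := by
  simp [goodForests]

theorem goodForests_eq_empty {t : ℕ} {n : Fin q →₀ ℕ} (h : n.degree < t) :
    goodForests t n = ∅ := by
  refine Finset.eq_empty_of_forall_notMem fun f hf => ?_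
  obtain ⟨hg, rfl, rfl⟩ := mem_goodForests.1 hf
  exact absurd hg.len_le_degree (by omega)

theorem sum_goodForests_zero (a : (Fin q →₀ ℕ) → ℕ → ℝ) (n : Fin q →₀ ℕ) :
    ∑ f ∈ goodForests 0 n, f.wt a = if n = 0 then 1 else 0 := by
  split_ifs with h
  · have : goodForests 0 n = {nil} := by
      ext f
      rw [mem_goodForests, Finset.mem_singleton]
      cases f with
      | nil => simp [Good, len, content, h]
      | cons s c r => simp [len]
    rw [this, Finset.sum_singleton, wt]
  · refine Finset.sum_eq_zero fun f hf => ?_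
    obtain ⟨_, h1, h2⟩ := mem_goodForests.1 hf
    cases f with
    | nil => exact absurd h2.symm h
    | cons s c r => simp [len] at h1

theorem sum_goodForests_succ {a : (Fin q →₀ ℕ) → ℕ → ℝ} (h0 : a 0 0 = 0) (h1 : a 0 1 = 0)
    (t : ℕ) (n : Fin q →₀ ℕ) {K : ℕ} (hK : n.degree < K) :
    ∑ f ∈ goodForests (t + 1) n, f.wt a
      = ∑ x ∈ Finset.HasAntidiagonal.antidiagonal n,
          (∑ y ∈ Finset.HasAntidiagonal.antidiagonal x.1, ∑ t' ∈ Finset.range K,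
          a y.1 t' * ∑ c ∈ goodForests t' y.2, c.wt a) * ∑ r ∈ goodForests t x.2, r.wt a := by
  simp only [Finset.sum_mul, Finset.mul_sum]
  simp only [Finset.sum_sigma']
  let e : SForest q → (Σ _ : (Fin q →₀ ℕ) × (Fin q →₀ ℕ), Σ _ : SForest q,
      Σ _ : (Fin q →₀ ℕ) × (Fin q →₀ ℕ), Σ _ : ℕ, SForest q) := fun f => match f with
    | nil => ⟨(0, 0), nil, (0, 0), 0, nil⟩
    | cons s c r => ⟨(s + c.content, r.content), r, (s, c.content), c.len, c⟩
  refine Finset.sum_of_injOn e ?_ ?_ ?_ ?_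
  · intro f hf f' hf' hff
    have h2 := (mem_goodForests.1 hf).2.1
    have h2' := (mem_goodForests.1 hf').2.1
    cases f with
    | nil => simp [len] at h2
    | cons s c r =>
      cases f' with
      | nil => simp [len] at h2'
      | cons s' c' r' =>
        simp only [e, Sigma.mk.injEq, Prod.mk.injEq, heq_eq_eq] at hff
        obtain ⟨_, rfl, ⟨rfl, _⟩, _, rfl⟩ := hff
        rfl
  · intro f hf
    obtain ⟨hg, h2, rfl⟩ := mem_goodForests.1 hf
    cases f with
    | nil => simp [len] at h2
    | cons s c r =>
      obtain ⟨_, hc, hr⟩ := hg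
      have hlen := hc.len_le_degree
      have hdeg : c.content.degree ≤ (cons s c r).content.degree := by
        simp only [content, map_add]
        omega
      simp only [len, Nat.add_right_cancel_iff] at h2
      simp only [e, Finset.mem_coe, Finset.mem_sigma, Finset.HasAntidiagonal.mem_antidiagonal,
        Finset.mem_range, mem_goodForests, content, hc, hr, h2, true_and, and_true]
      omega
  · rintro ⟨⟨x1, x2⟩, r, ⟨y1, y2⟩, t', c⟩ hz hne
    simp only [Finset.mem_sigma, Finset.HasAntidiagonal.mem_antidiagonal, Finset.mem_range,
      mem_goodForests] at hz
    obtain ⟨hx, ⟨hr, rfl, rfl⟩, hy, -, hc, rfl, rfl⟩ := hz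
    by_cases hb : y1 = 0 ∧ c.len ≤ 1
    · obtain ⟨rfl, hl⟩ := hb
      have : a 0 c.len = 0 := by
        obtain hl | hl : c.len = 0 ∨ c.len = 1 := by omega
        · rw [hl, h0]
        · rw [hl, h1]
      simp only [this, zero_mul]
    · refine absurd ⟨cons y1 c r, ?_, ?_⟩ hne
      · exact mem_goodForests.2 ⟨⟨hb, hc, hr⟩, rfl, by rw [content, hy, hx]⟩
      · simp only [e, hy]
  · intro f hf
    have h2 := (mem_goodForests.1 hf).2.1
    cases f with
    | nil => simp [len] at h2
    | cons s c r => rfl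

theorem coeff_pow_eq_sum {a : (Fin q →₀ ℕ) → ℕ → ℝ} (h0 : a 0 0 = 0) (h1 : a 0 1 = 0)
    {Y : MvPowerSeries (Fin q) ℝ} (hY : coeff 0 Y = 0)
    (hrec : ∀ (n : Fin q →₀ ℕ) (K : ℕ), n.degree < K → coeff n Y =
      ∑ x ∈ Finset.HasAntidiagonal.antidiagonal n, ∑ t ∈ Finset.range K, a x.1 t * coeff x.2 (Y ^ t))
    (t : ℕ) (n : Fin q →₀ ℕ) : coeff n (Y ^ t) = ∑ f ∈ goodForests t n, f.wt a := by
  have hlow {t : ℕ} {n : Fin q →₀ ℕ} (h : n.degree < t) : coeff n (Y ^ t) = 0 :=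
    MvPowerSeries.coeff_eq_zero_of_constantCoeff_nilpotent (m := 1) (by simpa using hY)
      (by omega)
  suffices H : ∀ (d t : ℕ) (n : Fin q →₀ ℕ), 2 * n.degree ≤ t + d →
      coeff n (Y ^ t) = ∑ f ∈ goodForests t n, f.wt a from H (2 * n.degree) t n (by omega)
  intro d
  induction d with
  | zero =>
    intro t n h
    by_cases hn : n.degree < t
    · rw [hlow hn, goodForests_eq_empty hn, Finset.sum_empty]
    obtain rfl : t = 0 := by omega
    rw [sum_goodForests_zero, pow_zero, MvPowerSeries.coeff_one]
  | succ d ih =>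
    intro t n h
    cases t with
    | zero => rw [sum_goodForests_zero, pow_zero, MvPowerSeries.coeff_one]
    | succ t =>
      rw [sum_goodForests_succ h0 h1 t n (Nat.lt_succ_self _), pow_succ', MvPowerSeries.coeff_mul]
      refine Finset.sum_congr rfl fun x hx => ?_
      have hxn : x.1.degree + x.2.degree = n.degree := by
        rw [← Finset.HasAntidiagonal.mem_antidiagonal.1 hx, map_add]
      rw [hrec x.1 (n.degree + 1) (by omega), Finset.sum_mul, Finset.sum_mul]
      refine Finset.sum_congr rfl fun y hy => ?_
      have hyx : y.1.degree + y.2.degree = x.1.degree := by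
        rw [← Finset.HasAntidiagonal.mem_antidiagonal.1 hy, map_add]
      rw [Finset.sum_mul, Finset.sum_mul]
      refine Finset.sum_congr rfl fun t' _ => ?_
      by_cases ha : a y.1 t' = 0
      · simp only [ha, zero_mul]
      by_cases hy2 : y.2.degree < t'
      · simp only [hlow hy2, goodForests_eq_empty hy2, Finset.sum_empty, mul_zero, zero_mul]
      by_cases hx2 : x.2.degree < t
      · rw [hlow hx2, goodForests_eq_empty hx2, Finset.sum_empty, mul_zero, mul_zero]
      have hgood : y.1.degree = 0 → 1 < t' := fun hy1 => by
        rw [(Finsupp.degree_eq_zero_iff _).1 hy1] at ha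
        by_contra ht
        obtain rfl | rfl : t' = 0 ∨ t' = 1 := by omega
        · exact ha h0
        · exact ha h1
      rw [ih t' y.2 (by omega), ih t x.2 (by omega)]

end SForest

end ImplicitDD

namespace ImplicitDD

section PlaneTrees

theorem leafCount_leaf : (PTree.node []).leafCount = 1 := by
  rw [PTree.leafCount]

theorem leafCount_node {ts : List PTree} (h : ts ≠ []) :
    (PTree.node ts).leafCount = (ts.map PTree.leafCount).sum := by
  cases ts with
  | nil => exact absurd rfl h
  | cons t ts =>
    rw [PTree.leafCount, List.attach_map_val (f := PTree.leafCount)]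
    exact h

theorem starRow_leaf_cons (ts : List PTree) (o : ℕ) :
    starRow (.node [] :: ts) o = some o :: starRow ts (o + 1) := by
  rw [starRow]

theorem starRow_cons {t : PTree} (ht : t ≠ .node []) (ts : List PTree) (o : ℕ) :
    starRow (t :: ts) o = none :: starRow ts (o + t.leafCount) := by
  rw [starRow]
  exact fun h => ht h

theorem starRow_of_forall_ne_leaf {us : List PTree} (h : ∀ u ∈ us, u ≠ .node []) (o : ℕ) :
    starRow us o = List.replicate us.length none := by
  induction us generalizing o with
  | nil => rw [starRow]; rfl
  | cons u us ih =>
    rw [starRow_cons (h u (by simp)), ih fun v hv => h v (by simp [hv])]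
    rfl

theorem starRow_replicate_append (a : ℕ) (us : List PTree) (o : ℕ) :
    starRow (List.replicate a (.node []) ++ us) o
      = (List.range' o a).map some ++ starRow us (o + a) := by
  induction a generalizing o with
  | zero => simp
  | succ a ih =>
    rw [List.replicate_succ, List.cons_append, starRow_leaf_cons, ih, List.range'_succ,
      Nat.add_right_comm, Nat.add_assoc]
    rfl

theorem starsList_nil (o : ℕ) : starsList [] o = [] := by rw [starsList]

theorem starsList_cons (t : PTree) (ts : List PTree) (o : ℕ) :
    starsList (t :: ts) o = t.stars o ++ starsList ts (o + t.leafCount) := by rw [starsList]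

theorem stars_leaf (o : ℕ) : (PTree.node []).stars o = [] := by rw [PTree.stars]

theorem stars_node {ts : List PTree} (h : ts ≠ []) (o : ℕ) :
    (PTree.node ts).stars o = starRow ts o :: starsList ts o := by
  rw [PTree.stars]
  exact h

theorem starsList_replicate_append (a : ℕ) (us : List PTree) (o : ℕ) :
    starsList (List.replicate a (.node []) ++ us) o = starsList us (o + a) := by
  induction a generalizing o with
  | zero => simp
  | succ a ih =>
    rw [List.replicate_succ, List.cons_append, starsList_cons, ih, stars_leaf, leafCount_leaf,
      Nat.add_right_comm, Nat.add_assoc]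
    rfl

theorem sum_leafCount_replicate_append (a : ℕ) (us : List PTree) :
    ((List.replicate a (PTree.node []) ++ us).map PTree.leafCount).sum
      = a + (us.map PTree.leafCount).sum := by
  simp [leafCount_leaf]

theorem forall_ne_leaf_of_starRow {us : List PTree} {o : ℕ}
    (h : ∀ j, some j ∉ starRow us o) : ∀ u ∈ us, u ≠ .node [] := by
  induction us generalizing o with
  | nil => simp
  | cons u us ih =>
    have hu : u ≠ .node [] := by
      rintro rfl
      exact h o (by simp [starRow_leaf_cons])
    rw [starRow_cons hu] at h
    intro v hv
    rcases List.mem_cons.1 hv with rfl | hv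
    · exact hu
    · exact ih (fun j hj => h j (List.mem_cons_of_mem _ hj)) v hv

/-- A star in which no leaf follows a nonleaf has all its leaves in front. -/
theorem exists_eq_replicate_append {cs : List PTree} {o : ℕ}
    (h : ∀ a b : ℕ, a < b → (starRow cs o)[a]? = some none →
      ∀ j : ℕ, (starRow cs o)[b]? ≠ some (some j)) :
    ∃ (a : ℕ) (us : List PTree), cs = List.replicate a (.node []) ++ us ∧
      ∀ u ∈ us, u ≠ .node [] := by
  induction cs generalizing o with
  | nil => exact ⟨0, [], by simp⟩
  | cons t cs ih =>
    by_cases ht : t = .node []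
    · subst ht
      rw [starRow_leaf_cons] at h
      obtain ⟨a, us, rfl, hus⟩ := ih fun a b hab ha j =>
        h (a + 1) (b + 1) (by omega) (by simpa using ha) j
      exact ⟨a + 1, us, by rw [List.replicate_succ, List.cons_append], hus⟩
    · rw [starRow_cons ht] at h
      refine ⟨0, t :: cs, by simp, fun u hu => ?_⟩
      rcases List.mem_cons.1 hu with rfl | hu
      · exact ht
      · refine forall_ne_leaf_of_starRow (o := o + t.leafCount) (fun j hj => ?_) u hu
        obtain ⟨b, hb⟩ := List.mem_iff_getElem?.1 hj
        exact h 0 (b + 1) (by omega) (by simp) j (by simpa using hb)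

theorem replicate_append_inj {a a' : ℕ} {us us' : List PTree} (hus : ∀ u ∈ us, u ≠ .node [])
    (hus' : ∀ u ∈ us', u ≠ .node [])
    (h : List.replicate a (.node []) ++ us = List.replicate a' (.node []) ++ us') :
    a = a' ∧ us = us' := by
  induction a generalizing a' with
  | zero =>
    cases a' with
    | zero => simpa using h
    | succ a' =>
      refine absurd rfl (hus (.node []) ?_)
      rw [List.replicate_zero, List.nil_append] at h
      simp [h, List.replicate_succ]
  | succ a ih =>
    cases a' with
    | zero =>
      refine absurd rfl (hus' (.node []) ?_)
      rw [List.replicate_zero, List.nil_append] at h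
      simp [← h, List.replicate_succ]
    | succ a' =>
      rw [List.replicate_succ, List.replicate_succ, List.cons_append, List.cons_append,
        List.cons.injEq] at h
      obtain ⟨h1, h2⟩ := ih h.2
      exact ⟨by omega, h2⟩

theorem sizeOf_le_replicate_append (a : ℕ) (us : List PTree) :
    sizeOf us ≤ sizeOf (List.replicate a (PTree.node []) ++ us) := by
  induction a with
  | zero => simp
  | succ a ih =>
    rw [List.replicate_succ, List.cons_append, List.cons.sizeOf_spec]
    omega

end PlaneTrees

section Words

variable {q : ℕ}

/-- The steps of the lattice path `pth` are the unit vectors given by the letters of `W`, and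
the path stops after them. -/
def Follows (pth : ℕ → Fin q → ℕ) (W : List (Fin q)) : Prop :=
  ∀ (j : ℕ) (r : Fin q), (pth (j + 1) = fun j' => pth j j' + unitv q r j') ↔ W[j]? = some r

theorem pairwise_sortedWord (m : Fin q → ℕ) : (sortedWord m).Pairwise (· ≤ ·) := by
  rw [sortedWord, List.pairwise_flatten]
  refine ⟨fun l hl => ?_, ?_⟩
  · obtain ⟨j, rfl⟩ := List.mem_ofFn.1 hl
    exact List.pairwise_replicate.2 (Or.inr le_rfl)
  · rw [List.pairwise_ofFn]
    intro i j hij x hx z hz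
    rw [List.eq_of_mem_replicate hx, List.eq_of_mem_replicate hz]
    exact hij.le

theorem eq_sortedWord {l : List (Fin q)} (h : l.Pairwise (· ≤ ·)) :
    l = sortedWord fun j => l.count j := by
  refine List.Perm.eq_of_pairwise' h (pairwise_sortedWord _) ?_
  rw [List.perm_iff_count]
  intro j
  rw [count_sortedWord]

theorem length_sortedWord_eq_zero {s : Fin q →₀ ℕ} : (sortedWord s).length = 0 ↔ s = 0 := by
  rw [List.length_eq_zero_iff]
  constructor
  · intro h
    ext j
    rw [← count_sortedWord s j, h]
    rfl
  · rintro rfl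
    exact sortedWord_zero

theorem sortedWord_injective : Function.Injective fun s : Fin q →₀ ℕ => sortedWord s := by
  intro s s' h
  ext j
  rw [← count_sortedWord s j, ← count_sortedWord s' j]
  exact congrArg _ h

variable {pth : ℕ → Fin q → ℕ} {W u : List (Fin q)} {o : ℕ}

theorem getElem?_add_of_prefix (hu : u <+: W.drop o) {i : ℕ} (hi : i < u.length) :
    W[o + i]? = some u[i] := by
  obtain ⟨v, hv⟩ := hu
  rw [← List.getElem?_drop, ← hv, List.getElem?_append_left hi, List.getElem?_eq_getElem hi]

theorem prefix_drop_of_append {v : List (Fin q)} (hu : u ++ v <+: W.drop o) :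
    v <+: W.drop (o + u.length) := by
  obtain ⟨w, hw⟩ := hu
  refine ⟨w, ?_⟩
  rw [← List.drop_drop, ← hw, List.append_assoc, List.drop_left]

theorem starT_leaves_append (a t : ℕ) :
    starT ((List.range' o a).map some ++ List.replicate t none) = t := by
  simp [starT, List.countP_map, List.countP_replicate, Function.comp_def]

theorem starS_leaves_append (hW : Follows pth W) (hu : u <+: W.drop o) (t : ℕ) :
    starS pth ((List.range' o u.length).map some ++ List.replicate t none)
      = fun r => u.count r := by
  funext r
  rw [starS, List.countP_append, List.countP_replicate, if_neg (by simp), add_zero,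
    List.countP_map]
  induction u generalizing o with
  | nil => simp
  | cons x u ih =>
    have hx : W[o]? = some x := getElem?_add_of_prefix hu (i := 0) (by simp)
    rw [List.length_cons, List.range'_succ, List.countP_cons, List.count_cons,
      ih (o := o + 1) (prefix_drop_of_append (u := [x]) hu)]
    simp [hW o r, hx]

theorem starHasType_leaves_append (hW : Follows pth W) (hu : u <+: W.drop o) (t : ℕ) :
    StarHasType pth ((List.range' o u.length).map some ++ List.replicate t none)
      ↔ u.Pairwise (· ≤ ·) := by
  have h1 : ∀ i < u.length,
      ((List.range' o u.length).map some ++ List.replicate t none)[i]? = some (some (o + i)) := by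
    intro i hi
    rw [List.getElem?_append_left (by simpa using hi)]
    simp [hi]
  have h2 : ∀ i j, ((List.range' o u.length).map some ++ List.replicate t none)[i]?
      = some (some j) → i < u.length := by
    intro i j h
    by_contra hi
    rw [List.getElem?_append_right (by simpa using hi), List.getElem?_replicate] at h
    split_ifs at h
    cases h
  constructor
  · rintro ⟨-, h⟩
    rw [List.pairwise_iff_getElem]
    intro i j hi hj hij
    exact h i j hij _ _ (h1 i hi) (h1 j hj) _ _ ((hW _ _).2 (getElem?_add_of_prefix hu hi))
      ((hW _ _).2 (getElem?_add_of_prefix hu hj))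
  · intro h
    refine ⟨fun i j hij hi k hj => ?_, fun i j hij ki kj hi hj r r' hr hr' => ?_⟩
    · rw [h1 i (hij.trans (h2 j k hj))] at hi
      cases hi
    · have hi' := h2 _ _ hi
      have hj' := h2 _ _ hj
      rw [h1 i hi'] at hi
      rw [h1 j hj'] at hj
      cases hi
      cases hj
      rw [hW, getElem?_add_of_prefix hu hi'] at hr
      rw [hW, getElem?_add_of_prefix hu hj'] at hr'
      cases hr
      cases hr'
      exact List.pairwise_iff_getElem.1 h i j hi' hj' hij

end Words

namespace SForest

variable {q : ℕ}

/-- The plane trees obtained by attaching to every vertex with label `s` a total of `|s|` leaves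
to the left of its children. -/
def toTrees : SForest q → List PTree
  | nil => []
  | cons s c r =>
    .node (List.replicate (sortedWord s).length (.node []) ++ c.toTrees) :: r.toTrees

/-- The labels of the leaves of `toTrees`, read from left to right. -/
def toWord : SForest q → List (Fin q)
  | nil => []
  | cons s c r => sortedWord s ++ c.toWord ++ r.toWord

theorem count_toWord (f : SForest q) (j : Fin q) : f.toWord.count j = f.content j := by
  induction f with
  | nil => rfl
  | cons s c r ihc ihr => simp [toWord, content, count_sortedWord, ihc, ihr, add_assoc]

theorem length_toTrees (f : SForest q) : f.toTrees.length = f.len := by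
  induction f with
  | nil => rfl
  | cons s c r _ ihr => simp [toTrees, len, ihr]

theorem Good.children_ne_nil {s : Fin q →₀ ℕ} {c : SForest q} (h : ¬ (s = 0 ∧ c.len ≤ 1)) :
    List.replicate (sortedWord s).length (.node []) ++ c.toTrees ≠ [] := by
  intro h'
  rw [← List.length_eq_zero_iff, List.length_append, List.length_replicate, length_toTrees] at h'
  exact h ⟨length_sortedWord_eq_zero.1 (by omega), by omega⟩

theorem Good.toTrees_ne_leaf {f : SForest q} (hf : f.Good) : ∀ u ∈ f.toTrees, u ≠ .node [] := by
  induction f with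
  | nil => simp [toTrees]
  | cons s c r _ ihr =>
    intro u hu
    rcases List.mem_cons.1 hu with rfl | hu
    · rw [Ne, PTree.node.injEq]
      exact Good.children_ne_nil hf.1
    · exact ihr hf.2.2 u hu

theorem Good.sum_leafCount_toTrees {f : SForest q} (hf : f.Good) :
    (f.toTrees.map PTree.leafCount).sum = f.toWord.length := by
  induction f with
  | nil => rfl
  | cons s c r ihc ihr =>
    rw [toTrees, List.map_cons, List.sum_cons, leafCount_node (Good.children_ne_nil hf.1),
      sum_leafCount_replicate_append, ihc hf.2.1, ihr hf.2.2, toWord, List.length_append,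
      List.length_append]

theorem Good.eq_of_toTrees_eq {f f' : SForest q} (hf : f.Good) (hf' : f'.Good)
    (h : f.toTrees = f'.toTrees) (hw : f.toWord = f'.toWord) : f = f' := by
  induction f generalizing f' with
  | nil =>
    cases f' with
    | nil => rfl
    | cons s c r => simp [toTrees] at h
  | cons s c r ihc ihr =>
    cases f' with
    | nil => simp [toTrees] at h
    | cons s' c' r' =>
      rw [toTrees, toTrees, List.cons.injEq, PTree.node.injEq] at h
      obtain ⟨h1, h2⟩ := replicate_append_inj hf.2.1.toTrees_ne_leaf hf'.2.1.toTrees_ne_leaf h.1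
      have h3 : c.toWord.length = c'.toWord.length := by
        rw [← hf.2.1.sum_leafCount_toTrees, ← hf'.2.1.sum_leafCount_toTrees, h2]
      rw [toWord, toWord] at hw
      obtain ⟨h4, h5⟩ := List.append_inj hw (by simp [h1, h3])
      obtain ⟨h6, h7⟩ := List.append_inj h4 h1
      rw [sortedWord_injective h6, ihc hf.2.1 hf'.2.1 h2 h7, ihr hf.2.2 hf'.2.2 h.2 h5]

variable {pth : ℕ → Fin q → ℕ} {W : List (Fin q)}

theorem Good.starRow_children {s : Fin q →₀ ℕ} {c : SForest q} (hc : c.Good) (o : ℕ) :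
    starRow (List.replicate (sortedWord s).length (.node []) ++ c.toTrees) o
      = (List.range' o (sortedWord s).length).map some ++ List.replicate c.len none := by
  rw [starRow_replicate_append, starRow_of_forall_ne_leaf hc.toTrees_ne_leaf, length_toTrees]

theorem Good.stars_toTrees_cons {s : Fin q →₀ ℕ} {c r : SForest q} (hf : (cons s c r).Good)
    (o : ℕ) :
    starsList (cons s c r).toTrees o
      = ((List.range' o (sortedWord s).length).map some ++ List.replicate c.len none)
        :: (starsList c.toTrees (o + (sortedWord s).length)
          ++ starsList r.toTrees (o + (sortedWord s ++ c.toWord).length)) := by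
  rw [toTrees, starsList_cons, stars_node (Good.children_ne_nil hf.1),
    leafCount_node (Good.children_ne_nil hf.1), sum_leafCount_replicate_append,
    starsList_replicate_append, Good.starRow_children hf.2.1, hf.2.1.sum_leafCount_toTrees,
    List.length_append, List.cons_append]

theorem Good.starHasType {f : SForest q} (hf : f.Good) (hW : Follows pth W) {o : ℕ}
    (h : f.toWord <+: W.drop o) :
    ∀ σ ∈ starsList f.toTrees o, StarHasType pth σ ∧ σ ≠ [none] := by
  induction f generalizing o with
  | nil => simp [toTrees, starsList_nil]
  | cons s c r ihc ihr =>
    rw [toWord] at h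
    have h' := (List.prefix_append _ _).trans h
    have h'' := (List.prefix_append _ _).trans h'
    rw [hf.stars_toTrees_cons]
    intro σ hσ
    rw [List.mem_cons, List.mem_append] at hσ
    rcases hσ with rfl | hσ | hσ
    · refine ⟨(starHasType_leaves_append hW h'' _).2 (pairwise_sortedWord _), fun h0 => hf.1 ?_⟩
      have h1 := congrArg starT h0
      have h2 := congrArg List.length h0
      rw [starT_leaves_append] at h1
      simp only [List.length_append, List.length_map, List.length_range', List.length_replicate,
        List.length_singleton] at h2
      have h3 : c.len = 1 := h1
      exact ⟨length_sortedWord_eq_zero.1 (by omega), h3.le⟩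
    · exact ihc hf.2.1 (prefix_drop_of_append h') σ hσ
    · exact ihr hf.2.2 (prefix_drop_of_append h) σ hσ

theorem Good.prod_stars {f : SForest q} (hf : f.Good) (hW : Follows pth W) {o : ℕ}
    (h : f.toWord <+: W.drop o) {a : (Fin q →₀ ℕ) → ℕ → ℝ} {b : (Fin q → ℕ) → ℕ → ℝ}
    (hab : ∀ s t, ¬ (s = 0 ∧ t ≤ 1) → a s t = b s t) :
    ((starsList f.toTrees o).map fun σ => b (starS pth σ) (starT σ)).prod = f.wt a := by
  induction f generalizing o with
  | nil => simp [toTrees, starsList_nil, wt]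
  | cons s c r ihc ihr =>
    rw [toWord] at h
    have h' := (List.prefix_append _ _).trans h
    have h'' := (List.prefix_append _ _).trans h'
    rw [hf.stars_toTrees_cons, List.map_cons, List.map_append, List.prod_cons, List.prod_append,
      ihc hf.2.1 (prefix_drop_of_append h'), ihr hf.2.2 (prefix_drop_of_append h),
      starT_leaves_append, starS_leaves_append hW h'', wt, hab _ _ hf.1, mul_assoc]
    simp only [count_sortedWord]

theorem exists_toTrees_eq (hW : Follows pth W) {ts : List PTree} (hts : ∀ t ∈ ts, t ≠ .node [])
    {o : ℕ} (ho : o + (ts.map PTree.leafCount).sum ≤ W.length)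
    (h : ∀ σ ∈ starsList ts o, StarHasType pth σ ∧ σ ≠ [none]) :
    ∃ f : SForest q, f.Good ∧ f.toTrees = ts ∧
      f.toWord = (W.drop o).take (ts.map PTree.leafCount).sum := by
  induction hk : sizeOf ts using Nat.strong_induction_on generalizing ts o with
  | _ k ih =>
  subst hk
  match ts with
  | [] => exact ⟨nil, trivial, rfl, by simp [toWord]⟩
  | .node cs :: ts =>
    have hcs : cs ≠ [] := fun h0 => hts (.node cs) (by simp) (by rw [h0])
    rw [starsList_cons, stars_node hcs, leafCount_node hcs] at h
    rw [List.map_cons, List.sum_cons, leafCount_node hcs] at ho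
    have hrow := h (starRow cs o) (by simp)
    obtain ⟨a, us, rfl, hus⟩ := exists_eq_replicate_append hrow.1.1
    have hsz := sizeOf_le_replicate_append a us
    rw [starRow_replicate_append, starRow_of_forall_ne_leaf hus] at hrow
    rw [sum_leafCount_replicate_append] at h ho
    rw [List.map_cons, List.sum_cons, leafCount_node hcs, sum_leafCount_replicate_append]
    have hlen : ((W.drop o).take a).length = a := by
      rw [List.length_take, List.length_drop]
      omega
    obtain ⟨fc, hc, hct, hcw⟩ := ih (sizeOf us)
      (by simp only [List.cons.sizeOf_spec, PTree.node.sizeOf_spec]; omega) hus (o := o + a)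
      (by omega)
      (fun σ hσ => h σ (by simp [starsList_replicate_append, hσ])) rfl
    obtain ⟨fr, hr, hrt, hrw⟩ := ih (sizeOf ts)
      (by simp only [List.cons.sizeOf_spec]; omega) (fun t ht => hts t (by simp [ht]))
      (o := o + (a + (us.map PTree.leafCount).sum)) (by omega)
      (fun σ hσ => h σ (by simp [hσ])) rfl
    have hsorted : ((W.drop o).take a).Pairwise (· ≤ ·) := by
      rw [← starHasType_leaves_append hW (List.take_prefix _ _) us.length, hlen]
      exact hrow.1
    set s : Fin q →₀ ℕ :=
      Finsupp.equivFunOnFinite.symm fun j => ((W.drop o).take a).count j with hs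
    have hsw : sortedWord s = (W.drop o).take a := (eq_sortedWord hsorted).symm
    have hclen : fc.len = us.length := by rw [← length_toTrees, hct]
    refine ⟨cons s fc fr, ⟨fun h0 => ?_, hc, hr⟩, ?_, ?_⟩
    · have ha : a = 0 := by rw [← hlen, ← hsw, length_sortedWord_eq_zero, h0.1]
      subst ha
      have h1 : us.length ≠ 1 := fun h1 => hrow.2 (by simp [h1])
      have h2 : us = [] := List.length_eq_zero_iff.1 (by omega)
      exact hcs (by simp [h2])
    · rw [toTrees, hsw, hlen, hct, hrt]
    · rw [toWord, hsw, hcw, hrw, ← List.drop_drop, ← List.take_add, ← List.drop_drop,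
        ← List.take_add]

end SForest

end ImplicitDD

namespace ImplicitDD

section Paths

variable {q : ℕ} {pth : ℕ → Fin q → ℕ} {W W' : List (Fin q)}

theorem Follows.eq (h : Follows pth W) (h' : Follows pth W') : W = W' :=
  List.ext_getElem? fun j => Option.ext fun r => (h j r).symm.trans (h' j r)

theorem Follows.eq_count (h : Follows pth W) (h0 : pth 0 = fun _ => 0) {m : ℕ}
    (hm : m ≤ W.length) (j : Fin q) : pth m j = (W.take m).count j := by
  induction m generalizing j with
  | zero => simp [h0]
  | succ m ih =>
    have hm' : m < W.length := hm
    rw [(h m W[m]).2 (List.getElem?_eq_getElem hm'), List.take_succ_eq_append_getElem hm',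
      List.count_append, List.count_singleton]
    simp [ih hm'.le, unitv, eq_comm (a := j)]

theorem follows_count_take (W : List (Fin q)) : Follows (fun m j => (W.take m).count j) W := by
  intro m r
  simp only [List.take_add_one]
  cases h : W[m]? with
  | none =>
    simp only [Option.toList_none, List.append_nil, reduceCtorEq, iff_false]
    intro h'
    have := congrFun h' r
    simp [unitv] at this
  | some x =>
    simp only [Option.toList_some, List.count_append, Option.some.injEq, funext_iff,
      Nat.add_left_cancel_iff, List.count_singleton, unitv]
    constructor
    · intro h'
      have := h' r
      simpa using this
    · rintro rfl j
      simp [eq_comm (a := j)]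

theorem length_eq_sum_count (W : List (Fin q)) : W.length = ∑ j, W.count j := by
  simpa using (Multiset.sum_count_eq_card (s := Finset.univ) (m := (W : Multiset (Fin q)))
    (by simp)).symm

variable {n : Fin q → ℕ}

theorem exists_follows {p : Fin ((∑ j, n j) + 1) → ∀ j : Fin q, Fin (n j + 1)}
    (hp : IsUnitPath n p) :
    ∃ W : List (Fin q), W.length = ∑ j, n j ∧ Follows (extPath n p) W ∧ ∀ j, W.count j = n j := by
  choose r hr using hp.2.2
  set W : List (Fin q) := List.ofFn fun i : Fin (∑ j, n j) => r i i.2 with hWdef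
  have hlen : W.length = ∑ j, n j := List.length_ofFn
  have hW : Follows (extPath n p) W := by
    intro m x
    by_cases hm : m < ∑ j, n j
    · have h1 : W[m]? = some (r m hm) := by simp [hWdef, hm]
      rw [h1, hr m hm, Option.some.injEq, funext_iff]
      simp only [Nat.add_left_cancel_iff, unitv]
      refine ⟨fun h => ?_, fun h => by simp [h]⟩
      have := h x
      by_contra hne
      simp [Ne.symm hne] at this
    · rw [List.getElem?_eq_none (by omega)]
      simp only [reduceCtorEq, iff_false]
      intro h
      have h1 : extPath n p (m + 1) = extPath n p m := by
        have h2 : min (m + 1) (∑ j, n j) = min m (∑ j, n j) := by omega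
        funext j
        simp only [extPath, h2]
      have := congrFun h x
      simp [h1, unitv] at this
  refine ⟨W, hlen, hW, fun j => ?_⟩
  have := hW.eq_count hp.1 hlen.ge j
  rw [hp.2.1, ← hlen, List.take_length] at this
  exact this.symm

theorem existsUnique_follows (hW : ∀ j, W.count j = n j) :
    ∃! p : Fin ((∑ j, n j) + 1) → ∀ j : Fin q, Fin (n j + 1),
      IsUnitPath n p ∧ Follows (extPath n p) W := by
  have hlen : W.length = ∑ j, n j := by simp only [length_eq_sum_count, hW]
  set p₀ : Fin ((∑ j, n j) + 1) → ∀ j : Fin q, Fin (n j + 1) := fun m j =>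
    ⟨(W.take m).count j, Nat.lt_succ_of_le (hW j ▸ (List.take_sublist _ _).count_le j)⟩ with hp₀
  have hext : extPath n p₀ = fun m j => (W.take m).count j := by
    funext m j
    change (W.take (min m (∑ j, n j))).count j = _
    rw [← hlen, ← List.take_eq_take_min]
  have hF : Follows (extPath n p₀) W := hext ▸ follows_count_take W
  refine ⟨p₀, ⟨⟨?_, ?_, fun m hm => ?_⟩, hF⟩, ?_⟩
  · simp [hext]
  · funext j
    simp only [hext, ← hlen, List.take_length, hW]
  · exact ⟨_, (hF m _).2 (List.getElem?_eq_getElem (hlen ▸ hm))⟩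
  · rintro p ⟨hp, hpF⟩
    funext m j
    have h1 : extPath n p m j = (p m j : ℕ) := by
      simp only [extPath, min_eq_left (Nat.le_of_lt_succ m.2)]
    refine Fin.ext ?_
    rw [← h1, hpF.eq_count hp.1 ((Nat.le_of_lt_succ m.2).trans hlen.ge)]

end Paths

namespace SForest

variable {q : ℕ}

/-- The first of the plane trees attached to a forest. -/
def toTree (f : SForest q) : PTree := f.toTrees.headD (.node [])

theorem toTrees_eq_singleton {f : SForest q} (h : f.len = 1) : f.toTrees = [f.toTree] := by
  rw [← length_toTrees, List.length_eq_one_iff] at h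
  obtain ⟨t, ht⟩ := h
  rw [toTree, ht]
  rfl

open Classical in
/-- A sum over decorated trees, rewritten as a sum over the leaf words and the underlying plane
trees. -/
theorem sum_goodForests_one_eq (n : Fin q →₀ ℕ) {a : (Fin q →₀ ℕ) → ℕ → ℝ}
    {b : (Fin q → ℕ) → ℕ → ℝ} (hab : ∀ s t, ¬ (s = 0 ∧ t ≤ 1) → a s t = b s t) :
    ∑ f ∈ goodForests 1 n, f.wt a
      = ∑ p : Fin ((∑ j, n j) + 1) → ∀ j : Fin q, Fin (n j + 1),
          if IsUnitPath n p then
            ∑ᶠ (τ : PTree)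
              (_ : τ ≠ PTree.node [] ∧ τ.leafCount = (∑ j, n j) ∧
                ∀ σ ∈ τ.stars 0, StarHasType (extPath n p) σ ∧ σ ≠ [none]),
              ((τ.stars 0).map fun σ => b (starS (extPath n p) σ) (starT σ)).prod
          else 0 := by
  have h1 : ∀ f ∈ goodForests 1 n, f.wt a
      = ∑ p : Fin ((∑ j, n j) + 1) → ∀ j : Fin q, Fin (n j + 1),
          if IsUnitPath n p ∧ Follows (extPath n p) f.toWord then f.wt a else 0 := by
    intro f hf
    obtain ⟨p, hp, hp'⟩ := existsUnique_follows (n := n) (W := f.toWord)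
      fun j => by rw [count_toWord, (mem_goodForests.1 hf).2.2]
    rw [Finset.sum_eq_single p (fun p' _ hne => if_neg fun h => hne (hp' p' h)) (by simp),
      if_pos hp]
  rw [Finset.sum_congr rfl h1, Finset.sum_comm]
  refine Finset.sum_congr rfl fun p _ => ?_
  split_ifs with hp
  swap
  · simp [hp]
  obtain ⟨W, hlen, hW, hcount⟩ := exists_follows hp
  simp only [hp, true_and]
  rw [← Finset.sum_filter, ← finsum_mem_coe_finset]
  have hmem : ∀ f, f ∈ ((goodForests 1 n).filter fun f => Follows (extPath n p) f.toWord) ↔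
      f.Good ∧ f.toTrees = [f.toTree] ∧ f.toWord = W := by
    intro f
    rw [Finset.mem_filter, mem_goodForests]
    constructor
    · rintro ⟨⟨h1, h2, -⟩, h4⟩
      exact ⟨h1, toTrees_eq_singleton h2, h4.eq hW⟩
    · rintro ⟨h1, h2, h3⟩
      refine ⟨⟨h1, by rw [← length_toTrees, h2]; rfl, ?_⟩, h3 ▸ hW⟩
      ext j
      rw [← count_toWord, h3, hcount]
  have hstars : ∀ τ : PTree, starsList [τ] 0 = τ.stars 0 := fun τ => by
    rw [starsList_cons, starsList_nil, List.append_nil]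
  refine finsum_mem_eq_of_bijOn (t := {τ : PTree | τ ≠ PTree.node [] ∧
    τ.leafCount = (∑ j, n j) ∧ ∀ σ ∈ τ.stars 0, StarHasType (extPath n p) σ ∧ σ ≠ [none]})
    toTree ⟨fun f hf => ?_, fun f hf f' hf' h => ?_, fun τ hτ => ?_⟩ fun f hf => ?_
  · obtain ⟨h1, h2, h3⟩ := (hmem f).1 hf
    refine ⟨h1.toTrees_ne_leaf _ (by simp [h2]), ?_, ?_⟩
    · rw [← hlen, ← h3, ← h1.sum_leafCount_toTrees, h2]
      simp
    · rw [← hstars, ← h2]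
      exact h1.starHasType hW (by simp [h3])
  · obtain ⟨h1, h2, h3⟩ := (hmem f).1 hf
    obtain ⟨h1', h2', h3'⟩ := (hmem f').1 hf'
    exact h1.eq_of_toTrees_eq h1' (by rw [h2, h2', h]) (h3.trans h3'.symm)
  · obtain ⟨h1, h2, h3⟩ := hτ
    obtain ⟨f, hf, hft, hfw⟩ := exists_toTrees_eq hW (ts := [τ]) (o := 0) (by simpa using h1)
      (by simp [h2, hlen]) (by rwa [hstars])
    have hτ : f.toTree = τ := by rw [toTree, hft]; rfl
    refine ⟨f, (hmem f).2 ⟨hf, by rw [hft, hτ], ?_⟩, hτ⟩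
    rw [hfw]
    simp [h2, ← hlen]
  · obtain ⟨h1, h2, h3⟩ := (hmem f).1 hf
    rw [← hstars, ← h2]
    exact (h1.prod_stars hW (by simp [h3]) hab).symm

end SForest

end ImplicitDD

namespace ImplicitDD

section Recursion

open scoped ContDiff Nat
open MvPowerSeries (coeff)

variable {q : ℕ} {U : Set (Fin q → ℝ)} {V : Set ℝ} {x₀ : Fin q → ℝ} {y : (Fin q → ℝ) → ℝ}
  {g : (Fin q → ℝ) → ℝ → ℝ}

/-- The factor `-(1 / (s! t!)) g_{s,t} / g_{0,1}` contributed by a star of type `(s, t)`. -/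
noncomputable def starWeight (g : (Fin q → ℝ) → ℝ → ℝ) (x₀ : Fin q → ℝ) (w : ℝ) (s : Fin q → ℕ)
    (t : ℕ) : ℝ :=
  -(1 / ((∏ r, ((s r)! : ℝ)) * (t ! : ℝ))) * (gPDeriv g s t x₀ w / gPDeriv g (fun _ => 0) 1 x₀ w)

theorem gPDeriv_zero (g : (Fin q → ℝ) → ℝ → ℝ) (t : ℕ) (v : Fin q → ℝ) (w : ℝ) :
    gPDeriv g (fun _ => 0) t v w = deriv^[t] (g v) w :=
  congrFun (mPDeriv_zero fun v' => deriv^[t] (g v') w) v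

theorem sum_starWeight_mul_coeff (hU : IsOpen U) (hV : IsOpen V) (hx : x₀ ∈ U)
    (hy : ContDiffOn ℝ ∞ y U) (hmaps : Set.MapsTo y U V)
    (hg : ContDiffOn ℝ ∞ (fun p : (Fin q → ℝ) × ℝ => g p.1 p.2) (U ×ˢ V))
    (himp : ∀ v ∈ U, g v (y v) = 0) {n : Fin q →₀ ℕ} {K : ℕ} (hK : n.degree < K) :
    ∑ x ∈ Finset.HasAntidiagonal.antidiagonal n, ∑ t ∈ Finset.range K,
      starWeight g x₀ (y x₀) x.1 t
        * coeff x.2 ((taylor x₀ y - MvPowerSeries.C (y x₀)) ^ t) = 0 := by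
  have h := coeff_taylor_graph hU hV hx hy hmaps hg hK
  have h0 : coeff n (taylor x₀ fun v => g v (y v)) = 0 := by
    have h1 := taylor_add hU hx (f := fun _ => 0) (h := fun _ => 0) contDiffOn_const
      contDiffOn_const
    simp only [add_zero] at h1
    rw [taylor_congr hU hx (f' := fun _ => 0) himp, left_eq_add.1 h1, map_zero]
  rw [h0, compSeries, map_sum] at h
  rw [Finset.sum_comm, ← mul_zero (-(1 / gPDeriv g (fun _ => 0) 1 x₀ (y x₀))), h, Finset.mul_sum]
  refine Finset.sum_congr rfl fun t _ => ?_
  rw [MvPowerSeries.coeff_smul, MvPowerSeries.coeff_mul, Finset.mul_sum, Finset.mul_sum]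
  refine Finset.sum_congr rfl fun x _ => ?_
  rw [coeff_taylor, starWeight, ← gPDeriv]
  ring

/-- The Taylor coefficients of an implicitly defined function as sums over decorated trees. -/
theorem coeff_taylor_eq_sum (hU : IsOpen U) (hV : IsOpen V) (hx : x₀ ∈ U)
    (hy : ContDiffOn ℝ ∞ y U) (hmaps : Set.MapsTo y U V)
    (hg : ContDiffOn ℝ ∞ (fun p : (Fin q → ℝ) × ℝ => g p.1 p.2) (U ×ˢ V))
    (himp : ∀ v ∈ U, g v (y v) = 0) (hdy : deriv (g x₀) (y x₀) ≠ 0) {n : Fin q →₀ ℕ}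
    (hn : n ≠ 0) :
    coeff n (taylor x₀ y) = ∑ f ∈ SForest.goodForests 1 n, f.wt fun s t =>
      starWeight g x₀ (y x₀) s t + if s = 0 ∧ t = 1 then 1 else 0 := by
  set Y := taylor x₀ y - MvPowerSeries.C (y x₀) with hYdef
  have hY : coeff 0 Y = 0 := by
    rw [hYdef, map_sub, coeff_zero_taylor, MvPowerSeries.coeff_zero_C, sub_self]
  have hnY : coeff n (taylor x₀ y) = coeff n (Y ^ 1) := by
    rw [pow_one, hYdef, map_sub, MvPowerSeries.coeff_C, if_neg hn, sub_zero]
  rw [hnY]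
  refine SForest.coeff_pow_eq_sum ?_ ?_ hY (fun m K hK => ?_) 1 n
  · have : gPDeriv g 0 0 x₀ (y x₀) = 0 :=
      (gPDeriv_zero g 0 x₀ (y x₀)).trans (himp x₀ hx)
    simp [starWeight, this]
  · have : gPDeriv g 0 1 x₀ (y x₀) = deriv (g x₀) (y x₀) :=
      gPDeriv_zero g 1 x₀ (y x₀)
    have h' : gPDeriv g (fun _ => 0) 1 x₀ (y x₀) = deriv (g x₀) (y x₀) := this
    simp [starWeight, this, h', div_self hdy]
  · simp only [add_mul, Finset.sum_add_distrib]
    rw [sum_starWeight_mul_coeff hU hV hx hy hmaps hg himp hK, zero_add,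
      Finset.sum_eq_single (0, m), Finset.sum_eq_single 1]
    · simp
    · intro t _ ht
      simp [ht]
    · intro h1
      have hm : m = 0 := by
        rw [Finset.mem_range] at h1
        rw [← Finsupp.degree_eq_zero_iff]
        omega
      simp [hm, hY]
    · rintro ⟨s, s'⟩ hs hne
      have h0 : s ≠ 0 := by
        rintro rfl
        rw [Finset.HasAntidiagonal.mem_antidiagonal, zero_add] at hs
        exact hne (by rw [← hs])
      simp [h0]
    · intro h0
      exact absurd (by simp [Finset.HasAntidiagonal.mem_antidiagonal]) h0

end Recursion

open Classical in
/-- (Coalesced Main Theorem, Equation (eq:IntermediateWilde).) If `y` is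
implicitly defined by `g` on an open box `U`, both sufficiently smooth, then for `x₀ ∈ U` and
nonzero `n ∈ ℕ^q`, `y_n(x₀)/n! = ∑_{0 = p₀ < ⋯ < p_{|n|} = n} ∑_{τ' ∈ 𝒯'(p₀,…,p_{|n|})}
∏_{★ ∈ Stars(τ')} (−(1/(s^★! t^★!)) g_{s^★,t^★}(x₀,y(x₀))/g_{0,1}(x₀,y(x₀)))`, where
`𝒯'(p₀,…,p_{|n|})` is the set of plane trees with `|n|` leaves, labeled in depth-first order
along the unit-step lattice path `p`, all of whose stars have a type `(s^★,t^★) ≠ (0,1)`. -/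
theorem implicit_partial_derivatives_trees
    {q : ℕ} (lo hi : Fin q → ℝ) (c d : ℝ)
    (y : (Fin q → ℝ) → ℝ) (g : (Fin q → ℝ) → ℝ → ℝ)
    (hmaps : ∀ v ∈ Set.univ.pi fun j => Set.Ioo (lo j) (hi j), y v ∈ Set.Ioo c d)
    (hsmoothg : ContDiffOn ℝ (⊤ : ℕ∞) (fun p : (Fin q → ℝ) × ℝ => g p.1 p.2)
      ((Set.univ.pi fun j => Set.Ioo (lo j) (hi j)) ×ˢ Set.Ioo c d))
    (hsmoothy : ContDiffOn ℝ (⊤ : ℕ∞) y (Set.univ.pi fun j => Set.Ioo (lo j) (hi j)))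
    (himp : ∀ v ∈ Set.univ.pi fun j => Set.Ioo (lo j) (hi j), g v (y v) = 0)
    (hdy : ∀ v ∈ Set.univ.pi fun j => Set.Ioo (lo j) (hi j), deriv (g v) (y v) ≠ 0) :
    ∀ x₀ ∈ Set.univ.pi fun j => Set.Ioo (lo j) (hi j),
      ∀ n : Fin q → ℕ, n ≠ (fun _ => 0) →
      mPDeriv n y x₀ / ∏ j, ((n j).factorial : ℝ)
        = ∑ p : Fin ((∑ j, n j) + 1) → ∀ j : Fin q, Fin (n j + 1),
            if IsUnitPath n p then
              ∑ᶠ (τ : PTree)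
                (_ : τ ≠ PTree.node [] ∧ τ.leafCount = (∑ j, n j) ∧
                  ∀ σ ∈ τ.stars 0, StarHasType (extPath n p) σ ∧ σ ≠ [none]),
                ((τ.stars 0).map fun σ =>
                  -(1 / ((∏ r, ((starS (extPath n p) σ r).factorial : ℝ))
                        * ((starT σ).factorial : ℝ)))
                    * (gPDeriv g (starS (extPath n p) σ) (starT σ) x₀ (y x₀)
                        / gPDeriv g (fun _ => 0) 1 x₀ (y x₀))).prod
            else 0 := by
  intro x₀ hx n hn
  set N : Fin q →₀ ℕ := Finsupp.equivFunOnFinite.symm n with hN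
  have hN0 : N ≠ 0 := fun h => hn (funext fun j => DFunLike.congr_fun h j)
  have hU : IsOpen (Set.univ.pi fun j => Set.Ioo (lo j) (hi j)) :=
    isOpen_set_pi Set.finite_univ fun _ _ => isOpen_Ioo
  have h1 := coeff_taylor_eq_sum hU isOpen_Ioo hx hsmoothy hmaps hsmoothg himp (hdy x₀ hx) hN0
  rw [SForest.sum_goodForests_one_eq N (b := starWeight g x₀ (y x₀)) fun s t h => by
    rw [if_neg fun h' => h ⟨h'.1, h'.2.le⟩, add_zero]] at h1
  exact h1

end ImplicitDD
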